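/- Let ν > −1. The function g_ν'(x) = 2^ν Γ(ν+1) x^{−ν} d_ν(x) is strictly log-concave on each component interval of Δ_ν; that is, (d/dx)(g_ν''(x)/g_ν'(x)) = −∑_{n≥1} 2(α_{ν,n}² + x²)/(α_{ν,n}² − x²)² < 0 for all x ∈ Δ_ν. -/

import Mathlib

open Real Filter Set

/-- The Bessel function of the first kind of order `ν`, defined by its power series. -/
noncomputable def besselJ (ν x : ℝ) : ℝ :=
  ∑' n : ℕ, (-1 : ℝ) ^ n * x ^ (2 * (n : ℝ) + ν) /
    (2 ^ (2 * (n : ℝ) + ν) * (n.factorial : ℝ) * Real.Gamma ((n : ℝ) + ν + 1))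

/-- The Dini function `d_ν(x) = (1-ν) J_ν(x) + x J_ν'(x) = J_ν(x) - x J_{ν+1}(x)`. -/
noncomputable def dini (ν x : ℝ) : ℝ :=
  besselJ ν x - x * besselJ (ν + 1) x

/-- The derivative `g_ν'` of `g_ν(x) = 2^ν Γ(ν+1) x^{1-ν} J_ν(x)`, namely
`g_ν'(x) = 2^ν Γ(ν+1) x^{-ν} d_ν(x)`. -/
noncomputable def gderiv (ν x : ℝ) : ℝ :=
  2 ^ ν * Real.Gamma (ν + 1) * x ^ (-ν) * dini ν x

open scoped Topology

/-- The sum of the power series with coefficients `c`. -/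
noncomputable def powSum (c : ℕ → ℝ) (z : ℝ) : ℝ := ∑' k, c k * z ^ k

/-- The coefficients of the derivative of a power series. -/
def derivCoeff (c : ℕ → ℝ) (k : ℕ) : ℝ := (k + 1) * c (k + 1)

/-- The power series with coefficients `c` converges absolutely everywhere. -/
def EntireCoeff (c : ℕ → ℝ) : Prop := ∀ R : ℝ, 1 ≤ R → Summable fun k => |c k| * R ^ k

lemma EntireCoeff.of_abs_le {c : ℕ → ℝ} {M : ℝ} (h : ∀ k, |c k| ≤ M / k.factorial) :
    EntireCoeff c := by
  intro R hR
  refine Summable.of_nonneg_of_le (fun k => by positivity) (fun k => ?_)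
    ((Real.summable_pow_div_factorial R).mul_left M)
  calc |c k| * R ^ k ≤ M / k.factorial * R ^ k := by gcongr; exact h k
    _ = _ := by ring

lemma EntireCoeff.derivCoeff {c : ℕ → ℝ} (h : EntireCoeff c) : EntireCoeff (derivCoeff c) := by
  intro R hR
  have h2 := (summable_nat_add_iff 1).2 (h (2 * R) (by linarith))
  refine Summable.of_nonneg_of_le (fun k => by positivity) (fun k => ?_) h2
  have hk : (k + 1 : ℝ) ≤ 2 ^ (k + 1) := by
    exact_mod_cast (Nat.lt_two_pow_self (n := k + 1)).le
  have hR' : R ^ k ≤ R ^ (k + 1) := pow_le_pow_right₀ hR (Nat.le_succ k)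
  rw [_root_.derivCoeff, abs_mul, abs_of_nonneg (by positivity : (0 : ℝ) ≤ k + 1), mul_pow]
  calc (k + 1 : ℝ) * |c (k + 1)| * R ^ k = |c (k + 1)| * ((k + 1) * R ^ k) := by ring
    _ ≤ |c (k + 1)| * (2 ^ (k + 1) * R ^ (k + 1)) := by gcongr

lemma EntireCoeff.summable_abs {c : ℕ → ℝ} (h : EntireCoeff c) (z : ℝ) :
    Summable fun k => |c k| * |z| ^ k :=
  Summable.of_nonneg_of_le (fun k => by positivity)
    (fun k => by gcongr; exact le_max_left |z| 1) (h (max |z| 1) (le_max_right _ _))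

lemma EntireCoeff.summable {c : ℕ → ℝ} (h : EntireCoeff c) (z : ℝ) :
    Summable fun k => c k * z ^ k :=
  Summable.of_norm (by simpa [abs_mul, abs_pow] using h.summable_abs z)

lemma EntireCoeff.hasDerivAt_powSum {c : ℕ → ℝ} (h : EntireCoeff c) (z : ℝ) :
    HasDerivAt (powSum c) (powSum (_root_.derivCoeff c) z) z := by
  set R : ℝ := |z| + 1 with hR
  have hR1 : 1 ≤ R := by rw [hR]; linarith [abs_nonneg z]
  have hz : z ∈ Metric.ball (0 : ℝ) R := by simp [hR]
  have hu : Summable fun k : ℕ => |c k| * (k * R ^ (k - 1)) := by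
    refine (summable_nat_add_iff 1).1 ?_
    refine (h.derivCoeff R hR1).congr (fun k => ?_)
    rw [_root_.derivCoeff, abs_mul, abs_of_nonneg (by positivity : (0 : ℝ) ≤ k + 1)]
    simp only [Nat.add_sub_cancel]; push_cast; ring
  have key := hasDerivAt_tsum_of_isPreconnected (g := fun (k : ℕ) (y : ℝ) => c k * y ^ k)
    (g' := fun k y => c k * (k * y ^ (k - 1))) (y₀ := z) (y := z) hu Metric.isOpen_ball
    (convex_ball (0 : ℝ) R).isPreconnected
    (fun k y _ => (hasDerivAt_pow k y).const_mul (c k))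
    (fun k y hy => by
      have hy' : |y| ≤ R := by simpa using (mem_ball_zero_iff.1 hy).le
      rw [norm_mul, norm_mul, norm_pow, Real.norm_eq_abs, Real.norm_eq_abs, Real.norm_eq_abs,
        Nat.abs_cast]
      gcongr) hz (h.summable z) hz
  convert! key using 1
  rw [tsum_eq_zero_add', powSum]
  · simp only [Nat.cast_zero, zero_mul, mul_zero, zero_add, Nat.add_sub_cancel,
      _root_.derivCoeff]
    refine tsum_congr fun k => ?_
    push_cast; ring
  · refine (h.derivCoeff.summable z).congr (fun k => ?_)
    simp only [Nat.add_sub_cancel, _root_.derivCoeff]; push_cast; ring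

lemma EntireCoeff.tendsto_powSum {c : ℕ → ℝ} (h : EntireCoeff c) {w : ℕ → ℕ → ℝ}
    (hw : ∀ k, Tendsto (fun n => w n k) atTop (𝓝 1)) (hw1 : ∀ n k, |w n k| ≤ 1) (z : ℝ) :
    Tendsto (fun n => powSum (fun k => w n k * c k) z) atTop (𝓝 (powSum c z)) := by
  refine tendsto_tsum_of_dominated_convergence (h.summable_abs z) (fun k => ?_)
    (Eventually.of_forall fun n k => ?_)
  · simpa using ((hw k).mul_const (c k)).mul_const (z ^ k)
  · rw [norm_mul, norm_mul, norm_pow, Real.norm_eq_abs, Real.norm_eq_abs, Real.norm_eq_abs]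
    have := mul_le_mul_of_nonneg_right (hw1 n k) (by positivity : 0 ≤ |c k| * |z| ^ k)
    linarith

lemma Polynomial.eval_eq_powSum (p : Polynomial ℝ) (z : ℝ) :
    p.eval z = powSum p.coeff z := by
  rw [powSum, Polynomial.eval_eq_sum_range, tsum_eq_sum]
  intro k hk
  rw [Polynomial.coeff_eq_zero_of_natDegree_lt (by simpa using hk), zero_mul]

lemma Polynomial.coeff_derivative_eq_derivCoeff (p : Polynomial ℝ) :
    p.derivative.coeff = derivCoeff p.coeff := by
  ext k
  rw [Polynomial.coeff_derivative, derivCoeff, mul_comm]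

/-- The rising factorial `a (a + 1) ⋯ (a + k - 1)`. -/
noncomputable def risingFact (a : ℝ) (k : ℕ) : ℝ := ∏ i ∈ Finset.range k, (a + i)

lemma risingFact_succ (a : ℝ) (k : ℕ) : risingFact a (k + 1) = risingFact a k * (a + k) :=
  Finset.prod_range_succ _ _

lemma risingFact_succ' (a : ℝ) (k : ℕ) : risingFact a (k + 1) = a * risingFact (a + 1) k := by
  rw [risingFact, Finset.prod_range_succ', mul_comm, risingFact]
  simp only [Nat.cast_zero, add_zero, Nat.cast_add, Nat.cast_one]
  congr 1
  exact Finset.prod_congr rfl fun i _ => by ring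

lemma risingFact_pos {a : ℝ} (ha : 0 < a) (k : ℕ) : 0 < risingFact a k :=
  Finset.prod_pos fun i _ => by positivity

lemma Gamma_eq_risingFact {a : ℝ} (ha : 0 < a) (k : ℕ) :
    Real.Gamma (a + k) = risingFact a k * Real.Gamma a := by
  induction k with
  | zero => simp [risingFact]
  | succ k ih =>
    rw [risingFact_succ, Nat.cast_succ, ← add_assoc, Real.Gamma_add_one (by positivity), ih]
    ring

lemma le_risingFact_succ {a : ℝ} (ha : 0 < a) (k : ℕ) :
    min 1 a * k.factorial ≤ risingFact a (k + 1) := by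
  induction k with
  | zero => simp [risingFact]
  | succ k ih =>
    rw [risingFact_succ, Nat.factorial_succ]
    push_cast
    have : 0 < min 1 a := lt_min one_pos ha
    calc min 1 a * ((k + 1) * k.factorial) = (min 1 a * k.factorial) * (k + 1) := by ring
      _ ≤ risingFact a (k + 1) * (a + (k + 1)) :=
        mul_le_mul ih (by linarith) (by positivity) (risingFact_pos ha _).le

lemma le_two_pow_mul_risingFact {a : ℝ} (ha : 0 < a) (k : ℕ) :
    min 1 a * k.factorial ≤ 2 ^ k * risingFact a k := by
  cases k with
  | zero => simp [risingFact]
  | succ k =>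
    have h1 := le_risingFact_succ ha k
    have hk : (k + 1 : ℝ) ≤ 2 ^ (k + 1) := by
      exact_mod_cast (Nat.lt_two_pow_self (n := k + 1)).le
    rw [Nat.factorial_succ]
    push_cast
    have : 0 < min 1 a := lt_min one_pos ha
    calc min 1 a * ((k + 1) * k.factorial) = (k + 1) * (min 1 a * k.factorial) := by ring
      _ ≤ _ := by gcongr

/-- The coefficients of the entire function `Φ` with
`J_ν(x) = (x / 2) ^ ν / Γ(ν + 1) * Φ(x ^ 2)`. -/
noncomputable def besselCoeff (ν : ℝ) (k : ℕ) : ℝ :=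
  (-1) ^ k / (4 ^ k * k.factorial * risingFact (ν + 1) k)

lemma abs_besselCoeff {ν : ℝ} (hν : -1 < ν) (k : ℕ) :
    |besselCoeff ν k| = 1 / (4 ^ k * k.factorial * risingFact (ν + 1) k) := by
  have := risingFact_pos (by linarith : 0 < ν + 1) k
  rw [besselCoeff, abs_div, abs_pow, abs_neg, abs_one, one_pow, abs_of_pos (by positivity)]

lemma entireCoeff_besselCoeff {ν : ℝ} (hν : -1 < ν) : EntireCoeff (besselCoeff ν) := by
  have ha : 0 < ν + 1 := by linarith
  have hm : 0 < min 1 (ν + 1) := lt_min one_pos ha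
  refine EntireCoeff.of_abs_le (M := 1 / min 1 (ν + 1)) (fun k => ?_)
  rw [abs_besselCoeff hν, div_div]
  have h1 := le_two_pow_mul_risingFact ha k
  have h2 : (1 : ℝ) ≤ k.factorial := by exact_mod_cast Nat.one_le_iff_ne_zero.2 k.factorial_ne_zero
  have hp := risingFact_pos ha k
  refine one_div_le_one_div_of_le (by positivity) ?_
  have h3 : (2 : ℝ) ^ k ≤ 4 ^ k := pow_le_pow_left₀ (by norm_num) (by norm_num) k
  calc min 1 (ν + 1) * k.factorial ≤ 2 ^ k * risingFact (ν + 1) k := h1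
    _ ≤ 4 ^ k * risingFact (ν + 1) k := by gcongr
    _ ≤ 4 ^ k * k.factorial * risingFact (ν + 1) k := by
      gcongr
      exact le_mul_of_one_le_right (by positivity) h2

lemma derivCoeff_besselCoeff {ν : ℝ} (hν : -1 < ν) (k : ℕ) :
    derivCoeff (besselCoeff ν) k = -(1 / (4 * (ν + 1))) * besselCoeff (ν + 1) k := by
  have ha : 0 < ν + 1 := by linarith
  have := risingFact_pos (by linarith : 0 < ν + 1 + 1) k
  rw [derivCoeff, besselCoeff, besselCoeff, risingFact_succ', Nat.factorial_succ]
  push_cast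
  field_simp
  ring

lemma powSum_derivCoeff_besselCoeff {ν : ℝ} (hν : -1 < ν) (z : ℝ) :
    powSum (derivCoeff (besselCoeff ν)) z =
      -(1 / (4 * (ν + 1))) * powSum (besselCoeff (ν + 1)) z := by
  simp only [powSum, derivCoeff_besselCoeff hν]
  rw [← tsum_mul_left]
  congr 1; ext k; ring

/-- The entire function `g_ν'(x)` as a function of `z = x ^ 2`. -/
noncomputable def diniSum (ν z : ℝ) : ℝ :=
  powSum (besselCoeff ν) z + 2 * z * powSum (derivCoeff (besselCoeff ν)) z

lemma besselJ_eq {ν : ℝ} (hν : -1 < ν) {x : ℝ} (hx : 0 < x) :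
    besselJ ν x = x ^ ν / (2 ^ ν * Real.Gamma (ν + 1)) * powSum (besselCoeff ν) (x ^ 2) := by
  have ha : 0 < ν + 1 := by linarith
  rw [besselJ, powSum, ← tsum_mul_left]
  congr 1; ext n
  have hG : Real.Gamma ((n : ℝ) + ν + 1) = risingFact (ν + 1) n * Real.Gamma (ν + 1) := by
    rw [← Gamma_eq_risingFact ha]; ring_nf
  have e (y : ℝ) (hy : 0 < y) : y ^ (2 * (n : ℝ) + ν) = (y ^ 2) ^ n * y ^ ν := by
    rw [Real.rpow_add hy, ← pow_mul, ← Real.rpow_natCast]; push_cast; rfl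
  rw [hG, e x hx, e 2 two_pos, besselCoeff]
  have h1 := Real.Gamma_pos_of_pos ha
  have h2 := risingFact_pos ha n
  norm_num
  field_simp

lemma gderiv_eq {ν : ℝ} (hν : -1 < ν) {x : ℝ} (hx : 0 < x) :
    gderiv ν x = diniSum ν (x ^ 2) := by
  have ha : 0 < ν + 1 := by linarith
  have h1 := Real.Gamma_pos_of_pos ha
  rw [gderiv, dini, besselJ_eq hν hx, besselJ_eq (by linarith : -1 < ν + 1) hx, diniSum,
    powSum_derivCoeff_besselCoeff hν, Real.Gamma_add_one ha.ne', Real.rpow_add two_pos,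
    Real.rpow_add hx, Real.rpow_neg hx.le, Real.rpow_one, Real.rpow_one]
  have := Real.rpow_pos_of_pos hx ν
  have := Real.rpow_pos_of_pos two_pos ν
  field_simp
  ring

lemma dini_eq_zero_iff {ν : ℝ} (hν : -1 < ν) {x : ℝ} (hx : 0 < x) :
    dini ν x = 0 ↔ diniSum ν (x ^ 2) = 0 := by
  have := Real.Gamma_pos_of_pos (by linarith : 0 < ν + 1)
  have := Real.rpow_pos_of_pos hx (-ν)
  rw [← gderiv_eq hν hx, gderiv, mul_eq_zero_iff_left (by positivity)]

lemma hasDerivAt_diniSum {ν : ℝ} (hν : -1 < ν) (z : ℝ) :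
    HasDerivAt (diniSum ν) (3 * powSum (derivCoeff (besselCoeff ν)) z +
      2 * z * powSum (derivCoeff (derivCoeff (besselCoeff ν))) z) z := by
  have h := entireCoeff_besselCoeff hν
  have h2 := (h.hasDerivAt_powSum z).add
    (((hasDerivAt_id z).const_mul 2).mul (h.derivCoeff.hasDerivAt_powSum z))
  exact h2.congr_deriv (by simp only [id]; ring)

lemma powSum_besselCoeff_contiguous {ν : ℝ} (hν : -1 < ν) (z : ℝ) :
    powSum (besselCoeff ν) z = powSum (besselCoeff (ν + 1)) z -
      z / (4 * (ν + 1) * (ν + 2)) * powSum (besselCoeff (ν + 2)) z := by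
  have h0 := (entireCoeff_besselCoeff hν).summable z
  have h1 := (entireCoeff_besselCoeff (by linarith : -1 < ν + 1)).summable z
  have h2 := (entireCoeff_besselCoeff (by linarith : -1 < ν + 2)).summable z
  simp only [powSum]
  have e0 : besselCoeff ν 0 = besselCoeff (ν + 1) 0 := by simp [besselCoeff, risingFact]
  rw [h0.tsum_eq_zero_add, e0, h1.tsum_eq_zero_add, ← tsum_mul_left, add_sub_assoc,
    ← Summable.tsum_sub ((summable_nat_add_iff 1).2 h1) (h2.mul_left _)]
  congr 1
  refine tsum_congr fun k => ?_
  have ha : 0 < ν + 1 := by linarith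
  have hr := risingFact_pos (by linarith : 0 < ν + 2 + 1) k
  have e1 : risingFact (ν + 1) (k + 1) =
      (ν + 1) * (ν + 2) * risingFact (ν + 2 + 1) k / (ν + 2 + k) := by
    have := risingFact_succ (ν + 1 + 1) k
    rw [risingFact_succ'] at this
    have hk : 0 < ν + 2 + (k : ℝ) := by have : (0:ℝ) ≤ k := by positivity
                                        linarith
    rw [eq_div_iff hk.ne', risingFact_succ', show ν + 2 + (k : ℝ) = ν + 1 + 1 + k by ring,
      mul_assoc, ← this]
    ring_nf
  have e2 : risingFact (ν + 1 + 1) (k + 1) = (ν + 2) * risingFact (ν + 2 + 1) k := by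
    rw [risingFact_succ']; ring_nf
  have hk : 0 < ν + 2 + (k : ℝ) := by have : (0:ℝ) ≤ k := by positivity
                                      linarith
  have h2' : 0 < ν + 2 := by linarith
  rw [besselCoeff, besselCoeff, besselCoeff, e1, e2, Nat.factorial_succ]
  push_cast
  field_simp
  ring

lemma tendsto_powSum_besselCoeff (ν z : ℝ) :
    Tendsto (fun n : ℕ => powSum (besselCoeff (ν + n)) z) atTop (𝓝 1) := by
  have hlim : powSum (fun k => if k = 0 then 1 else 0) z = 1 := by
    rw [powSum, tsum_eq_single 0 (fun k hk => by simp [hk])]; simp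
  rw [← hlim]
  have hν : Tendsto (fun n : ℕ => ν + n) atTop atTop :=
    tendsto_atTop_add_const_left _ _ tendsto_natCast_atTop_atTop
  have hle (k : ℕ) {μ : ℝ} (hμ : 0 ≤ μ) : 1 ≤ risingFact (μ + 1) k := by
    rw [risingFact]
    refine (Finset.prod_const_one (s := Finset.range k)).symm.trans_le
      (Finset.prod_le_prod (fun _ _ => zero_le_one) fun i _ => ?_)
    have : (0 : ℝ) ≤ i := by positivity
    linarith
  refine tendsto_tsum_of_dominated_convergence (Real.summable_pow_div_factorial |z|)
    (fun k => ?_) ?_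
  · refine Tendsto.mul_const _ ?_
    rcases k with _ | k
    · simp [besselCoeff, risingFact]
    · simp only [Nat.add_eq_zero_iff, one_ne_zero, and_false, if_false]
      refine squeeze_zero_norm' ?_ (tendsto_inv_atTop_zero.comp hν)
      filter_upwards [hν.eventually_ge_atTop 1] with n hn
      rw [Real.norm_eq_abs, abs_besselCoeff (by linarith), risingFact_succ', one_div,
        Function.comp_apply]
      have h1 : 1 ≤ risingFact (ν + n + 1 + 1) k := hle k (by linarith)
      have h2 : (1 : ℝ) ≤ 4 ^ (k + 1) * (k + 1).factorial :=
        one_le_mul_of_one_le_of_one_le (one_le_pow₀ (by norm_num))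
          (by exact_mod_cast Nat.one_le_iff_ne_zero.2 (k + 1).factorial_ne_zero)
      refine inv_anti₀ (by linarith) ?_
      have h3 : ν + n ≤ (ν + n + 1) * risingFact (ν + n + 1 + 1) k := by nlinarith
      nlinarith
  · filter_upwards [hν.eventually_ge_atTop 1] with n hn k
    rw [norm_mul, norm_pow, Real.norm_eq_abs, Real.norm_eq_abs, abs_besselCoeff (by linarith),
      div_mul_eq_mul_div, one_mul]
    have h1 : 1 ≤ risingFact (ν + n + 1) k := hle k (by linarith)
    have h2 : (1 : ℝ) ≤ 4 ^ k := one_le_pow₀ (by norm_num)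
    have h3 : (0 : ℝ) < k.factorial := by positivity
    gcongr
    have h4 : (k.factorial : ℝ) ≤ 4 ^ k * k.factorial := le_mul_of_one_le_left h3.le h2
    nlinarith

lemma powSum_besselCoeff_ne_zero {ν : ℝ} (hν : -1 < ν) {z : ℝ} (hz : 0 < z)
    (h0 : powSum (besselCoeff ν) z = 0) : powSum (derivCoeff (besselCoeff ν)) z ≠ 0 := by
  intro h1
  rw [powSum_derivCoeff_besselCoeff hν] at h1
  have h1' : powSum (besselCoeff (ν + 1)) z = 0 := by
    have : 0 < ν + 1 := by linarith
    rcases mul_eq_zero.1 h1 with h | h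
    · exact absurd h (neg_ne_zero.2 (by positivity))
    · exact h
  have key (n : ℕ) : powSum (besselCoeff (ν + n)) z = 0 ∧
      powSum (besselCoeff (ν + (n + 1 : ℕ))) z = 0 := by
    induction n with
    | zero => simpa using ⟨h0, h1'⟩
    | succ n ih =>
      refine ⟨ih.2, ?_⟩
      have hn : (0 : ℝ) ≤ n := by positivity
      have hc := powSum_besselCoeff_contiguous (by linarith : -1 < ν + n) z
      rw [ih.1, add_assoc ν n 1, add_assoc ν n 2] at hc
      have i2 := ih.2
      push_cast at i2 ⊢
      rw [i2, zero_sub, eq_comm, neg_eq_zero, mul_eq_zero] at hc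
      rw [show (n : ℝ) + 1 + 1 = n + 2 by ring]
      refine hc.resolve_left (div_ne_zero hz.ne' (ne_of_gt ?_))
      have : 0 < ν + n + 1 := by linarith
      have : 0 < ν + n + 2 := by linarith
      nlinarith
  have := tendsto_powSum_besselCoeff ν z
  simp only [fun n => (key n).1] at this
  exact zero_ne_one (tendsto_nhds_unique tendsto_const_nhds this)

open Polynomial in
/-- The polynomial `p` has at least `N` distinct positive zeros. -/
def HasPosRoots (p : ℝ[X]) (N : ℕ) : Prop :=
  ∃ b : ℕ → ℝ, b 0 = 0 ∧ (∀ i < N, b i < b (i + 1)) ∧ ∀ i < N, p.eval (b (i + 1)) = 0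

lemma nonneg_of_lt_succ {b : ℕ → ℝ} {N : ℕ} (h0 : b 0 = 0) (hb : ∀ i < N, b i < b (i + 1))
    {i : ℕ} (hi : i ≤ N) : 0 ≤ b i := by
  induction i with
  | zero => exact h0.ge
  | succ i ih => exact (ih (by omega)).trans (hb i (by omega)).le

section Polynomials

open Polynomial

lemma HasPosRoots.of_interlace {q : ℝ[X]} {M : ℕ} {b : ℕ → ℝ} (h0 : b 0 = 0)
    (h : ∀ i < M, ∃ c, b i < c ∧ (i + 1 < M → c < b (i + 1)) ∧ q.eval c = 0) :
    HasPosRoots q M := by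
  choose! c hc1 hc2 hc3 using h
  refine ⟨fun i => i.casesOn 0 c, rfl, fun i hi => ?_, fun i hi => hc3 i hi⟩
  cases i with
  | zero => simpa [h0] using hc1 0 hi
  | succ i => exact (hc2 i (by omega) hi).trans (hc1 (i + 1) hi)

lemma hasDerivAt_rpow_mul_exp_mul_eval (p : ℝ[X]) (β δ : ℝ) {w : ℝ} (hw : 0 < w) :
    HasDerivAt (fun w => w ^ β * rexp (-δ * w) * p.eval w)
      (w ^ (β - 1) * rexp (-δ * w) *
        (C β * p + X * derivative p - C δ * X * p).eval w) w := by
  have h1 := Real.hasDerivAt_rpow_const (x := w) (p := β) (Or.inl hw.ne')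
  have h2 : HasDerivAt (fun w => rexp (-δ * w)) (rexp (-δ * w) * (-δ)) w := by
    simpa using ((hasDerivAt_id w).const_mul (-δ)).exp
  refine ((h1.mul h2).mul (p.hasDerivAt w)).congr_deriv ?_
  have : w ^ β = w ^ (β - 1) * w := by
    rw [← Real.rpow_add_one hw.ne']; ring_nf
  simp only [eval_sub, eval_add, eval_mul, eval_C, eval_X, Pi.mul_apply, this]
  ring

lemma exists_root_between (p : ℝ[X]) {β δ a b : ℝ} (hβ : 0 < β) (ha : 0 ≤ a) (hab : a < b)
    (hpa : a = 0 ∨ p.eval a = 0) (hpb : p.eval b = 0) :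
    ∃ c, a < c ∧ c < b ∧ (C β * p + X * derivative p - C δ * X * p).eval c = 0 := by
  have hc : ContinuousOn (fun w => w ^ β * rexp (-δ * w) * p.eval w) (Icc a b) := by
    refine Continuous.continuousOn ?_
    have := Real.continuous_rpow_const hβ.le
    fun_prop
  have hfa : a ^ β * rexp (-δ * a) * p.eval a = 0 := by
    rcases hpa with h | h
    · simp [h, Real.zero_rpow hβ.ne']
    · simp [h]
  obtain ⟨c, hc, h⟩ := exists_hasDerivAt_eq_zero hab hc (by simp only [hfa, hpb, mul_zero])
    (fun x hx => hasDerivAt_rpow_mul_exp_mul_eval p β δ (ha.trans_lt hx.1))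
  have : 0 < c := ha.trans_lt hc.1
  have := Real.rpow_pos_of_pos this (β - 1)
  exact ⟨c, hc.1, hc.2, (mul_eq_zero.1 h).resolve_left (by positivity)⟩

lemma tendsto_rpow_mul_exp_mul_eval (p : ℝ[X]) (β : ℝ) :
    Tendsto (fun w => w ^ β * rexp (-1 * w) * p.eval w) atTop (𝓝 0) := by
  have key (k : ℕ) : Tendsto (fun w : ℝ => p.coeff k * (w ^ (β + k) * rexp (-1 * w))) atTop
      (𝓝 0) := by
    simpa using (tendsto_rpow_mul_exp_neg_mul_atTop_nhds_zero (β + k) 1 one_pos).const_mul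
      (p.coeff k)
  have := tendsto_finsetSum (Finset.range (p.natDegree + 1)) fun k _ => key k
  rw [Finset.sum_const_zero] at this
  refine this.congr' ?_
  filter_upwards [eventually_gt_atTop 0] with w hw
  rw [eval_eq_sum_range, Finset.mul_sum]
  refine Finset.sum_congr rfl fun k _ => ?_
  rw [Real.rpow_add hw, Real.rpow_natCast]
  ring

lemma exists_root_gt (p : ℝ[X]) {β a : ℝ} (hβ : 0 < β) (ha : 0 ≤ a)
    (hpa : a = 0 ∨ p.eval a = 0) :
    ∃ c, a < c ∧ (C β * p + X * derivative p - C 1 * X * p).eval c = 0 := by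
  set h : ℝ → ℝ := fun w => w ^ β * rexp (-1 * w) * p.eval w with hh
  have hcont : Continuous h := by
    have := Real.continuous_rpow_const hβ.le
    fun_prop
  have hha : h a = 0 := by
    rcases hpa with h' | h'
    · simp [hh, h', Real.zero_rpow hβ.ne']
    · simp [hh, h']
  have hmap (t : ℝ) (ht : t ∈ Ioo (0 : ℝ) 1) : a < t⁻¹ + (a - 1) := by
    have := (one_lt_inv₀ ht.1).2 ht.2
    linarith
  obtain ⟨t, ht, h0⟩ := exists_hasDerivAt_eq_zero' (f := fun t => h (t⁻¹ + (a - 1))) (l := 0)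
    (zero_lt_one' ℝ)
    ((tendsto_rpow_mul_exp_mul_eval p β).comp
      (tendsto_atTop_add_const_right _ _ tendsto_inv_nhdsGT_zero))
    (by
      have hc : ContinuousAt (fun t => h (t⁻¹ + (a - 1))) 1 :=
        hcont.continuousAt.comp ((continuousAt_inv₀ one_ne_zero).add continuousAt_const)
      have := hc.tendsto
      simp only [inv_one, add_sub_cancel, hha] at this
      exact this.mono_left nhdsWithin_le_nhds)
    (fun t ht => HasDerivAt.comp (h₂ := h) t
      (hasDerivAt_rpow_mul_exp_mul_eval p β 1 (ha.trans_lt (hmap t ht)))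
      ((hasDerivAt_inv ht.1.ne').add_const (a - 1)))
  have hc := hmap t ht
  have := Real.rpow_pos_of_pos (ha.trans_lt hc) (β - 1)
  refine ⟨_, hc, ?_⟩
  have hne : -(t ^ 2)⁻¹ ≠ 0 := neg_ne_zero.2 (inv_ne_zero (pow_ne_zero 2 ht.1.ne'))
  exact (mul_eq_zero.1 ((mul_eq_zero.1 h0).resolve_right hne)).resolve_left (by positivity)

lemma HasPosRoots.euler {p : ℝ[X]} {N : ℕ} (h : HasPosRoots p N) {β : ℝ} (hβ : 0 < β) :
    HasPosRoots (C β * p + X * derivative p) N := by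
  obtain ⟨b, h0, hlt, hr⟩ := h
  refine HasPosRoots.of_interlace h0 fun i hi => ?_
  obtain ⟨c, h1, h2, h3⟩ := exists_root_between p (δ := 0) hβ
    (nonneg_of_lt_succ h0 hlt hi.le) (hlt i hi) (by
      cases i with
      | zero => exact Or.inl h0
      | succ i => exact Or.inr (hr i (by omega))) (hr i hi)
  exact ⟨c, h1, fun _ => h2, by simpa using h3⟩

lemma HasPosRoots.euler_sub {p : ℝ[X]} {N : ℕ} (h : HasPosRoots p N) {β : ℝ} (hβ : 0 < β) :
    HasPosRoots (C β * p + X * derivative p - X * p) (N + 1) := by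
  obtain ⟨b, h0, hlt, hr⟩ := h
  refine HasPosRoots.of_interlace h0 fun i hi => ?_
  have hb := nonneg_of_lt_succ h0 hlt (Nat.lt_succ_iff.1 hi)
  have hb' : b i = 0 ∨ p.eval (b i) = 0 := by
    cases i with
    | zero => exact Or.inl h0
    | succ i => exact Or.inr (hr i (by omega))
  by_cases hiN : i < N
  · obtain ⟨c, h1, h2, h3⟩ := exists_root_between p (δ := 1) hβ hb (hlt i hiN) hb' (hr i hiN)
    exact ⟨c, h1, fun _ => h2, by simpa using h3⟩
  · obtain ⟨c, h1, h3⟩ := exists_root_gt p hβ hb hb'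
    exact ⟨c, h1, fun h => by omega, by simpa using h3⟩

lemma HasPosRoots.const_mul {p : ℝ[X]} {N : ℕ} (h : HasPosRoots p N) (a : ℝ) :
    HasPosRoots (C a * p) N := by
  obtain ⟨b, h0, hlt, hr⟩ := h
  exact ⟨b, h0, hlt, fun i hi => by simp [hr i hi]⟩

lemma HasPosRoots.comp_mul {p : ℝ[X]} {N : ℕ} (h : HasPosRoots p N) {a : ℝ} (ha : 0 < a) :
    HasPosRoots (p.comp (C a * X)) N := by
  obtain ⟨b, h0, hlt, hr⟩ := h
  refine ⟨fun i => b i / a, by simp [h0], fun i hi => ?_, fun i hi => ?_⟩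
  · exact div_lt_div_of_pos_right (hlt i hi) ha
  · rw [eval_comp, eval_mul, eval_C, eval_X, mul_div_cancel₀ _ ha.ne', hr i hi]

lemma HasPosRoots.eq_prod {p : ℝ[X]} {N : ℕ} (h : HasPosRoots p N) (hdeg : p.natDegree ≤ N)
    (hp0 : p.eval 0 = 1) : ∃ r : ℕ → ℝ, Antitone r ∧ (∀ i, 0 ≤ r i) ∧ (∀ i, N ≤ i → r i = 0) ∧
      p = ∏ i ∈ Finset.range N, (1 - C (r i) * X) := by
  obtain ⟨b, h0, hlt, hr⟩ := h
  have hpos : ∀ i < N, 0 < b (i + 1) := fun i hi =>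
    (nonneg_of_lt_succ h0 hlt hi.le).trans_lt (hlt i hi)
  have hmono : StrictMonoOn b (Iic N) := by
    refine strictMonoOn_of_lt_succ ordConnected_Iic fun a _ _ ha => ?_
    exact hlt a ha
  refine ⟨fun i => if i < N then (b (i + 1))⁻¹ else 0, ?_, fun i => ?_, fun i hi => ?_, ?_⟩
  · refine antitone_nat_of_succ_le fun i => ?_
    split_ifs with h1 h2
    · exact inv_anti₀ (hpos i h2) (hlt (i + 1) h1).le
    · omega
    · exact inv_nonneg.2 (hpos i ‹_›).le
    · exact le_rfl
  · dsimp only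
    split_ifs with h1
    · exact inv_nonneg.2 (hpos i h1).le
    · exact le_rfl
  · simp [hi.not_gt]
  · refine eq_of_natDegree_lt_card_of_eval_eq' _ _ ((Finset.range (N + 1)).image b) ?_ ?_
    · intro x hx
      obtain ⟨i, hi, rfl⟩ := Finset.mem_image.1 hx
      rw [eval_prod]
      cases i with
      | zero => simp [h0, hp0]
      | succ i =>
        have hiN : i < N := by simpa using hi
        rw [hr i hiN, eq_comm]
        refine Finset.prod_eq_zero (Finset.mem_range.2 hiN) ?_
        simp [hiN, (hpos i hiN).ne']
    · rw [Finset.card_image_of_injOn, Finset.card_range]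
      · refine Nat.lt_succ_iff.2 (max_le hdeg ?_)
        refine (natDegree_prod_le _ _).trans ((Finset.sum_le_card_nsmul _ _ 1 fun i _ => ?_).trans
          (by simp))
        compute_degree
      · exact hmono.injOn.mono fun i hi => by
          simpa [Nat.lt_succ_iff] using hi

/-- A strengthened Laguerre inequality for real-rooted polynomials with positive zeros. -/
lemma laguerre_inequality {ι : Type*} (s : Finset ι) (r : ι → ℝ) (hr : ∀ i, 0 ≤ r i) {z : ℝ}
    (hz : 0 ≤ z) {p : ℝ[X]} (hp : p = ∏ i ∈ s, (1 - C (r i) * X)) :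
    0 ≤ 2 * z * ((derivative p).eval z ^ 2 - p.eval z * (derivative (derivative p)).eval z) -
      p.eval z * (derivative p).eval z := by
  classical
  subst hp
  induction s using Finset.induction_on with
  | empty => simp
  | insert a s ha ih =>
    rw [Finset.prod_insert ha]
    set P := ∏ i ∈ s, (1 - C (r i) * X)
    have hpos : 0 ≤ r a + r a ^ 2 * z := by have := hr a; positivity
    have h1 := mul_nonneg (sq_nonneg (1 - r a * z)) ih
    have h2 := mul_nonneg (sq_nonneg (P.eval z)) hpos
    simp only [derivative_mul, derivative_sub, derivative_one, derivative_C, derivative_X,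
      derivative_add, derivative_neg, eval_mul, eval_add, eval_sub, eval_one, eval_C, eval_X,
      eval_zero, zero_sub, mul_one, zero_mul, zero_add, eval_neg] at h1 h2 ⊢
    linarith

/-- The Laguerre polynomial of degree `N` and parameter `ν`, normalized to be `1` at `0`. -/
noncomputable def laguerrePoly (ν : ℝ) (N : ℕ) : ℝ[X] :=
  ∑ k ∈ Finset.range (N + 1), monomial k ((-1) ^ k * (N.choose k : ℝ) / risingFact (ν + 1) k)

lemma coeff_laguerrePoly (ν : ℝ) (N k : ℕ) :
    (laguerrePoly ν N).coeff k = (-1) ^ k * (N.choose k : ℝ) / risingFact (ν + 1) k := by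
  rw [laguerrePoly, finsetSum_coeff]
  simp only [coeff_monomial]
  rw [Finset.sum_ite_eq' (Finset.range (N + 1)) k]
  split_ifs with h
  · rfl
  · rw [Nat.choose_eq_zero_of_lt (by simpa using h)]
    simp

lemma natDegree_laguerrePoly_le (ν : ℝ) (N : ℕ) : (laguerrePoly ν N).natDegree ≤ N := by
  rw [natDegree_le_iff_coeff_eq_zero]
  intro k hk
  rw [coeff_laguerrePoly, Nat.choose_eq_zero_of_lt hk]
  simp

lemma laguerrePoly_succ {ν : ℝ} (hν : -1 < ν) (N : ℕ) :
    laguerrePoly ν (N + 1) = C (ν + N + 1)⁻¹ * (C (ν + N + 1) * laguerrePoly ν N +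
      X * derivative (laguerrePoly ν N) - X * laguerrePoly ν N) := by
  have hN : 0 < ν + N + 1 := by have : (0 : ℝ) ≤ N := by positivity
                                linarith
  ext k
  rw [coeff_C_mul, coeff_sub, coeff_add, coeff_C_mul, eq_inv_mul_iff_mul_eq₀ hN.ne']
  cases k with
  | zero => simp [coeff_laguerrePoly, risingFact]
  | succ k =>
    rw [coeff_X_mul, coeff_X_mul, coeff_derivative]
    simp only [coeff_laguerrePoly]
    have hr := risingFact_pos (by linarith : 0 < ν + 1) k
    have hk : 0 < ν + 1 + k := by have : (0 : ℝ) ≤ k := by positivity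
                                  linarith
    rw [risingFact_succ, Nat.choose_succ_succ]
    have e : (N.choose (k + 1) : ℝ) * (k + 1) = N.choose k * (N - k) := by
      have := Nat.choose_succ_right_eq N k
      rcases le_or_gt k N with h | h
      · rw [← Nat.cast_sub h]; exact_mod_cast this
      · simp [Nat.choose_eq_zero_of_lt h, Nat.choose_eq_zero_of_lt (Nat.lt_succ_of_lt h)]
    push_cast
    field_simp
    linear_combination (-1) ^ k * e

lemma hasPosRoots_laguerrePoly {ν : ℝ} (hν : -1 < ν) (N : ℕ) :
    HasPosRoots (laguerrePoly ν N) N := by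
  induction N with
  | zero => exact ⟨fun _ => 0, rfl, by simp, by simp⟩
  | succ N ih =>
    rw [laguerrePoly_succ hν]
    have : (0 : ℝ) ≤ N := by positivity
    exact (ih.euler_sub (by linarith)).const_mul _

/-- The Jensen polynomials of the entire function with coefficients `besselCoeff ν`. -/
noncomputable def besselPoly (ν : ℝ) (N : ℕ) : ℝ[X] :=
  (laguerrePoly ν N).comp (C (1 / (4 * N : ℝ)) * X)

/-- The Jensen polynomials of the entire function `diniSum ν`. -/
noncomputable def diniPoly (ν : ℝ) (N : ℕ) : ℝ[X] :=
  besselPoly ν N + C 2 * X * derivative (besselPoly ν N)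

lemma hasPosRoots_besselPoly {ν : ℝ} (hν : -1 < ν) {N : ℕ} (hN : N ≠ 0) :
    HasPosRoots (besselPoly ν N) N :=
  (hasPosRoots_laguerrePoly hν N).comp_mul (by positivity)

lemma hasPosRoots_diniPoly {ν : ℝ} (hν : -1 < ν) {N : ℕ} (hN : N ≠ 0) :
    HasPosRoots (diniPoly ν N) N := by
  have := ((hasPosRoots_besselPoly hν hN).euler (one_half_pos (α := ℝ))).const_mul 2
  convert this using 1
  rw [diniPoly, mul_add, ← mul_assoc, ← mul_assoc, ← C_mul]
  norm_num

lemma natDegree_besselPoly_le (ν : ℝ) (N : ℕ) : (besselPoly ν N).natDegree ≤ N := by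
  rw [natDegree_le_iff_coeff_eq_zero]
  intro k hk
  rw [besselPoly, comp_C_mul_X_coeff, coeff_eq_zero_of_natDegree_lt
    ((natDegree_laguerrePoly_le ν N).trans_lt hk), zero_mul]

lemma natDegree_diniPoly_le (ν : ℝ) (N : ℕ) : (diniPoly ν N).natDegree ≤ N := by
  have h := natDegree_besselPoly_le ν N
  refine natDegree_add_le_of_degree_le h ?_
  rw [natDegree_le_iff_coeff_eq_zero] at h ⊢
  intro k hk
  rw [mul_assoc, coeff_C_mul]
  cases k with
  | zero => simp
  | succ k => rw [coeff_X_mul, coeff_derivative, h _ hk]; simp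

lemma besselPoly_eval_zero (ν : ℝ) (N : ℕ) : (besselPoly ν N).eval 0 = 1 := by
  rw [besselPoly, eval_comp, eval_mul, eval_X, mul_zero, ← coeff_zero_eq_eval_zero,
    coeff_laguerrePoly]
  simp [risingFact]

lemma diniPoly_eval_zero (ν : ℝ) (N : ℕ) : (diniPoly ν N).eval 0 = 1 := by
  simp [diniPoly, besselPoly_eval_zero]

/-- The weight `N (N - 1) ⋯ (N - k + 1) / N ^ k` of the `k`-th coefficient of a Jensen
polynomial. -/
noncomputable def jensenWeight (N k : ℕ) : ℝ := N.descFactorial k / N ^ k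

lemma jensenWeight_nonneg (N k : ℕ) : 0 ≤ jensenWeight N k := by
  rw [jensenWeight]; positivity

lemma jensenWeight_le_one (N k : ℕ) : jensenWeight N k ≤ 1 :=
  div_le_one_of_le₀ (by exact_mod_cast Nat.descFactorial_le_pow N k) (by positivity)

lemma tendsto_jensenWeight (k : ℕ) : Tendsto (fun N => jensenWeight N k) atTop (𝓝 1) := by
  have h : ∀ᶠ N : ℕ in atTop, (N ^ k : ℝ) ≠ 0 := by
    filter_upwards [eventually_ne_atTop 0] with N hN
    positivity
  exact (Asymptotics.isEquivalent_iff_tendsto_one h).1 (isEquivalent_descFactorial k)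

lemma coeff_besselPoly (ν : ℝ) (N : ℕ) :
    (besselPoly ν N).coeff = fun k => jensenWeight N k * besselCoeff ν k := by
  ext k
  rw [besselPoly, comp_C_mul_X_coeff, coeff_laguerrePoly, jensenWeight, besselCoeff,
    Nat.descFactorial_eq_factorial_mul_choose, div_pow, mul_pow]
  push_cast
  have : (k.factorial : ℝ) ≠ 0 := by positivity
  field_simp
  simp

lemma tendsto_eval_besselPoly {ν : ℝ} (hν : -1 < ν) (z : ℝ) :
    Tendsto (fun N => (besselPoly ν N).eval z) atTop (𝓝 (powSum (besselCoeff ν) z)) := by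
  simp only [eval_eq_powSum, coeff_besselPoly]
  exact (entireCoeff_besselCoeff hν).tendsto_powSum tendsto_jensenWeight
    (fun n k => by rw [abs_of_nonneg (jensenWeight_nonneg n k)]; exact jensenWeight_le_one n k) z

lemma tendsto_eval_derivative_besselPoly {ν : ℝ} (hν : -1 < ν) (z : ℝ) :
    Tendsto (fun N => (derivative (besselPoly ν N)).eval z) atTop
      (𝓝 (powSum (derivCoeff (besselCoeff ν)) z)) := by
  have := (entireCoeff_besselCoeff hν).derivCoeff.tendsto_powSum
    (w := fun N k => jensenWeight N (k + 1)) (fun k => tendsto_jensenWeight (k + 1))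
    (fun n k => by rw [abs_of_nonneg (jensenWeight_nonneg n _)]; exact jensenWeight_le_one n _) z
  refine this.congr fun N => ?_
  rw [eval_eq_powSum, coeff_derivative_eq_derivCoeff, coeff_besselPoly]
  congr 1; ext k
  simp only [derivCoeff]; ring

lemma tendsto_eval_derivative_derivative_besselPoly {ν : ℝ} (hν : -1 < ν) (z : ℝ) :
    Tendsto (fun N => (derivative (derivative (besselPoly ν N))).eval z) atTop
      (𝓝 (powSum (derivCoeff (derivCoeff (besselCoeff ν))) z)) := by
  have := (entireCoeff_besselCoeff hν).derivCoeff.derivCoeff.tendsto_powSum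
    (w := fun N k => jensenWeight N (k + 2)) (fun k => tendsto_jensenWeight (k + 2))
    (fun n k => by rw [abs_of_nonneg (jensenWeight_nonneg n _)]; exact jensenWeight_le_one n _) z
  refine this.congr fun N => ?_
  rw [eval_eq_powSum, coeff_derivative_eq_derivCoeff, coeff_derivative_eq_derivCoeff,
    coeff_besselPoly]
  congr 1; ext k
  simp only [derivCoeff]; ring

lemma tendsto_eval_diniPoly {ν : ℝ} (hν : -1 < ν) (z : ℝ) :
    Tendsto (fun N => (diniPoly ν N).eval z) atTop (𝓝 (diniSum ν z)) := by
  have := (tendsto_eval_besselPoly hν z).add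
    ((tendsto_eval_derivative_besselPoly hν z).const_mul (2 * z))
  simpa [diniPoly, diniSum] using this

/-- The positive zeros of `diniSum ν` are simple. -/
lemma deriv_diniSum_ne_zero {ν : ℝ} (hν : -1 < ν) {z : ℝ} (hz : 0 < z)
    (h0 : diniSum ν z = 0) : deriv (diniSum ν) z ≠ 0 := by
  intro h1
  rw [(hasDerivAt_diniSum hν z).deriv] at h1
  rw [diniSum] at h0
  have hlim := (((tendsto_eval_derivative_besselPoly hν z).pow 2).sub
    ((tendsto_eval_besselPoly hν z).mul
      (tendsto_eval_derivative_derivative_besselPoly hν z))).const_mul (2 * z) |>.sub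
    ((tendsto_eval_besselPoly hν z).mul (tendsto_eval_derivative_besselPoly hν z))
  have hineq := ge_of_tendsto hlim (by
    filter_upwards [eventually_ge_atTop 1] with N hN
    obtain ⟨r, -, hr, -, hp⟩ := (hasPosRoots_besselPoly hν (by omega : N ≠ 0)).eq_prod
      (natDegree_besselPoly_le ν N) (besselPoly_eval_zero ν N)
    exact laguerre_inequality _ r hr hz.le hp)
  set A := powSum (besselCoeff ν) z with hA0
  set A1 := powSum (derivCoeff (besselCoeff ν)) z
  set A2 := powSum (derivCoeff (derivCoeff (besselCoeff ν))) z
  have hA : A = -2 * z * A1 := by linarith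
  have h2 : 2 * z * A2 = -3 * A1 := by linarith
  have h3 : 2 * z * (A1 ^ 2 - A * A2) - A * A1 = -2 * z * A1 ^ 2 := by
    rw [hA]; linear_combination 2 * z * A1 * h2
  have h4 : A1 = 0 := by
    have : A1 ^ 2 ≤ 0 := by
      by_contra! h
      have := mul_pos hz h
      linarith
    exact pow_eq_zero_iff two_ne_zero |>.1 (le_antisymm this (sq_nonneg _))
  exact powSum_besselCoeff_ne_zero hν hz (by rw [← hA0, hA, h4, mul_zero]) h4

end Polynomials

lemma coeff_diniPoly (ν : ℝ) (N k : ℕ) :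
    (diniPoly ν N).coeff k = (2 * k + 1) * (jensenWeight N k * besselCoeff ν k) := by
  rw [diniPoly, Polynomial.coeff_add, mul_assoc, Polynomial.coeff_C_mul, coeff_besselPoly]
  cases k with
  | zero => simp
  | succ k =>
    rw [Polynomial.coeff_X_mul, Polynomial.coeff_derivative, coeff_besselPoly]
    push_cast; ring

lemma abs_besselCoeff_le {ν : ℝ} (hν : -1 < ν) (k : ℕ) :
    (2 * k + 1) * |besselCoeff ν k| ≤ 1 / min 1 (ν + 1) * (8 ^ k / (2 * k).factorial) := by
  have ha : 0 < ν + 1 := by linarith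
  have hm : 0 < min 1 (ν + 1) := lt_min one_pos ha
  have hr := risingFact_pos ha k
  have h1 := le_two_pow_mul_risingFact ha k
  have h2 : ((2 * k).factorial : ℝ) ≤ 4 ^ k * (k.factorial * k.factorial) := by
    have e := Nat.choose_mul_factorial_mul_factorial (n := 2 * k) (k := k) (by omega)
    have hc : (2 * k).choose k ≤ 4 ^ k := by
      calc (2 * k).choose k ≤ 2 ^ (2 * k) := Nat.choose_le_two_pow _ _
        _ = 4 ^ k := by rw [pow_mul]; norm_num
    rw [show 2 * k - k = k by omega] at e
    rw [← e]
    push_cast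
    rw [mul_assoc]
    gcongr
    exact_mod_cast hc
  have h3 : (2 * k + 1 : ℝ) ≤ 4 ^ k := by
    have (m : ℕ) : 2 * m + 1 ≤ 4 ^ m := by
      induction m with
      | zero => simp
      | succ m ih => rw [pow_succ]; omega
    exact_mod_cast this k
  rw [abs_besselCoeff hν, mul_one_div, one_div_mul_eq_div, div_div,
    div_le_div_iff₀ (by positivity) (by positivity)]
  calc (2 * k + 1 : ℝ) * ((2 * k).factorial * min 1 (ν + 1))
      ≤ 4 ^ k * ((4 ^ k * (k.factorial * k.factorial)) * min 1 (ν + 1)) := by gcongr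
    _ = 4 ^ k * 4 ^ k * k.factorial * (min 1 (ν + 1) * k.factorial) := by ring
    _ ≤ 4 ^ k * 4 ^ k * k.factorial * (2 ^ k * risingFact (ν + 1) k) := by gcongr
    _ = (4 * 2) ^ k * (4 ^ k * k.factorial * risingFact (ν + 1) k) := by rw [mul_pow]; ring
    _ = _ := by norm_num

lemma eval_diniPoly_neg_sq_le {ν : ℝ} (hν : -1 < ν) (N : ℕ) {y : ℝ} (hy : 0 ≤ y) :
    (diniPoly ν N).eval (-y ^ 2) ≤ 1 / min 1 (ν + 1) * rexp (3 * y) := by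
  have hm : 0 < min 1 (ν + 1) := lt_min one_pos (by linarith)
  have hcosh := (Real.hasSum_cosh (3 * y)).mul_left (1 / min 1 (ν + 1))
  have hle (k : ℕ) : ‖(diniPoly ν N).coeff k * (-y ^ 2) ^ k‖ ≤
      1 / min 1 (ν + 1) * ((3 * y) ^ (2 * k) / (2 * k).factorial) := by
    have h0 := abs_besselCoeff_le hν k
    have hw := jensenWeight_nonneg N k
    have hw1 := jensenWeight_le_one N k
    rw [coeff_diniPoly, norm_mul, norm_pow, norm_neg, norm_pow, norm_mul, norm_mul,
      Real.norm_of_nonneg hw, Real.norm_of_nonneg hy,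
      Real.norm_of_nonneg (by positivity : (0 : ℝ) ≤ 2 * k + 1), Real.norm_eq_abs]
    calc (2 * k + 1) * (jensenWeight N k * |besselCoeff ν k|) * (y ^ 2) ^ k
        = jensenWeight N k * ((2 * k + 1) * |besselCoeff ν k|) * (y ^ 2) ^ k := by ring
      _ ≤ 1 * (1 / min 1 (ν + 1) * (8 ^ k / (2 * k).factorial)) * (y ^ 2) ^ k := by gcongr
      _ ≤ 1 * (1 / min 1 (ν + 1) * (9 ^ k / (2 * k).factorial)) * (y ^ 2) ^ k := by
        gcongr; norm_num
      _ = 1 / min 1 (ν + 1) * ((3 * y) ^ (2 * k) / (2 * k).factorial) := by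
        rw [pow_mul (3 * y), mul_pow 3 y, mul_pow (3 ^ 2)]; norm_num; ring
  rw [Polynomial.eval_eq_powSum, powSum]
  calc ∑' k, (diniPoly ν N).coeff k * (-y ^ 2) ^ k
      ≤ ∑' k : ℕ, 1 / min 1 (ν + 1) * ((3 * y) ^ (2 * k) / (2 * k).factorial) :=
        (Summable.of_norm_bounded hcosh.summable hle).tsum_le_tsum
          (fun k => (le_abs_self _).trans (hle k)) hcosh.summable
    _ = 1 / min 1 (ν + 1) * Real.cosh (3 * y) := hcosh.tsum_eq
    _ ≤ 1 / min 1 (ν + 1) * rexp (3 * y) := by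
      gcongr
      rw [Real.cosh_eq]
      have : rexp (-(3 * y)) ≤ rexp (3 * y) := Real.exp_le_exp.2 (by linarith)
      linarith

/-- Quadratic decay of the reciprocals of the zeros of the Jensen polynomials. -/
lemma le_of_diniPoly_eq_prod {ν : ℝ} (hν : -1 < ν) {N : ℕ} {r : ℕ → ℝ} (hanti : Antitone r)
    (hr : ∀ i, 0 ≤ r i) (hN : ∀ i, N ≤ i → r i = 0)
    (hp : diniPoly ν N = ∏ i ∈ Finset.range N, (1 - Polynomial.C (r i) * Polynomial.X)) (k : ℕ) :
    r k ≤ 1 / min 1 (ν + 1) * rexp 3 / (k + 1) ^ 2 := by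
  have hm : 0 < min 1 (ν + 1) := lt_min one_pos (by linarith)
  have hm1 : 1 ≤ 1 / min 1 (ν + 1) := by
    rw [one_le_div hm]; exact min_le_left _ _
  rcases le_or_gt N k with h | h
  · rw [hN k h]; positivity
  have h1 := eval_diniPoly_neg_sq_le hν N (by positivity : (0 : ℝ) ≤ k + 1)
  have h2 : (1 + r k * (k + 1 : ℝ) ^ 2) ^ (k + 1) ≤
      (1 / min 1 (ν + 1) * rexp 3) ^ (k + 1) := by
    calc (1 + r k * (k + 1 : ℝ) ^ 2) ^ (k + 1)
        = ∏ i ∈ Finset.range (k + 1), (1 + r k * (k + 1 : ℝ) ^ 2) := by simp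
      _ ≤ ∏ i ∈ Finset.range (k + 1), (1 + r i * (k + 1 : ℝ) ^ 2) := by
        refine Finset.prod_le_prod (fun i _ => ?_) fun i hi => ?_
        · have := hr k; positivity
        · have := hanti (Nat.lt_succ_iff.1 (Finset.mem_range.1 hi))
          gcongr
      _ ≤ ∏ i ∈ Finset.range N, (1 + r i * (k + 1 : ℝ) ^ 2) := by
        refine Finset.prod_le_prod_of_subset_of_one_le (Finset.range_mono h) (fun i _ => ?_)
          fun i _ _ => ?_
        · have := hr i; positivity
        · have := hr i
          have : 0 ≤ r i * (k + 1 : ℝ) ^ 2 := by positivity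
          linarith
      _ = (diniPoly ν N).eval (-(k + 1 : ℝ) ^ 2) := by
        rw [hp, Polynomial.eval_prod]
        refine Finset.prod_congr rfl fun i _ => ?_
        simp
      _ ≤ 1 / min 1 (ν + 1) * rexp (3 * (k + 1)) := h1
      _ ≤ (1 / min 1 (ν + 1)) ^ (k + 1) * rexp (3 * (k + 1)) := by
        gcongr
        exact le_self_pow₀ hm1 (Nat.succ_ne_zero k)
      _ = (1 / min 1 (ν + 1) * rexp 3) ^ (k + 1) := by
        rw [mul_pow, ← Real.exp_nat_mul]; push_cast; ring_nf
  have h3 := (pow_le_pow_iff_left₀ (by have := hr k; positivity) (by positivity)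
    (Nat.succ_ne_zero k)).1 h2
  rw [le_div_iff₀ (by positivity)]
  linarith

lemma summable_div_succ_sq (B : ℝ) : Summable fun k : ℕ => B / (k + 1 : ℝ) ^ 2 := by
  have := (summable_nat_add_iff 1).2 (Real.summable_one_div_nat_pow.2 one_lt_two)
  simpa [div_eq_mul_inv] using this.mul_left B

/-- Hadamard factorization of `diniSum ν`. -/
lemma exists_diniSum_eq_tprod {ν : ℝ} (hν : -1 < ν) :
    ∃ r : ℕ → ℝ, Antitone r ∧ (∀ i, 0 ≤ r i) ∧ Summable r ∧
      ∀ z, diniSum ν z = ∏' i, (1 + -(r i * z)) := by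
  set B := 1 / min 1 (ν + 1) * rexp 3
  choose R hanti hnonneg hzero hprod using fun N : ℕ =>
    (hasPosRoots_diniPoly hν N.succ_ne_zero).eq_prod (natDegree_diniPoly_le ν _)
      (diniPoly_eval_zero ν _)
  have hB (N k : ℕ) : R N k ≤ B / (k + 1) ^ 2 :=
    le_of_diniPoly_eq_prod hν (hanti N) (hnonneg N) (hzero N) (hprod N) k
  have hK : IsCompact (Set.univ.pi fun k : ℕ => Icc (0 : ℝ) (B / (k + 1) ^ 2)) :=
    isCompact_univ_pi fun k => isCompact_Icc
  obtain ⟨r, hr, φ, hφ, hlim⟩ := hK.tendsto_subseq (x := R)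
    fun N k _ => ⟨hnonneg N k, hB N k⟩
  have hlim' (k : ℕ) : Tendsto (fun n => R (φ n) k) atTop (𝓝 (r k)) :=
    (tendsto_pi_nhds.1 hlim) k
  have hr0 (i : ℕ) : 0 ≤ r i := (hr i trivial).1
  refine ⟨r, fun i j hij => ?_, hr0, ?_, fun z => ?_⟩
  · exact le_of_tendsto_of_tendsto' (hlim' j) (hlim' i) fun n => hanti _ hij
  · exact Summable.of_nonneg_of_le hr0 (fun k => (hr k trivial).2) (summable_div_succ_sq B)
  · have h1 : Tendsto (fun n => ∏' k, (1 + -(R (φ n) k * z))) atTop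
        (𝓝 (∏' k, (1 + -(r k * z)))) := by
      refine tendsto_tprod_one_add_of_dominated_convergence
        ((summable_div_succ_sq B).mul_right |z|) (fun k => ((hlim' k).mul_const z).neg)
        (Eventually.of_forall fun n k => ?_)
      rw [norm_neg, norm_mul, Real.norm_of_nonneg (hnonneg _ _), Real.norm_eq_abs]
      gcongr
      exact hB _ _
    have h2 := (tendsto_eval_diniPoly hν z).comp
      ((tendsto_add_atTop_nat 1).comp hφ.tendsto_atTop)
    refine tendsto_nhds_unique (h2.congr fun n => ?_) h1
    simp only [Function.comp_apply]
    rw [hprod (φ n), Polynomial.eval_prod, tprod_eq_prod (s := Finset.range (φ n).succ)]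
    · refine Finset.prod_congr rfl fun i _ => ?_
      simp [sub_eq_add_neg]
    · intro i hi
      rw [hzero (φ n) i (by simpa using hi)]
      simp

lemma norm_one_add_neg_mul {r : ℕ → ℝ} (hr : ∀ i, 0 ≤ r i) (z : ℝ) :
    (fun i => ‖-(r i * z)‖) = fun i => r i * |z| := by
  ext i
  rw [norm_neg, norm_mul, Real.norm_of_nonneg (hr i), Real.norm_eq_abs]

lemma abs_tprod_le_of_eq {r : ℕ → ℝ} (hr : ∀ i, 0 ≤ r i) (hs : Summable r) {i j : ℕ}
    (hij : i ≠ j) (h : r i = r j) (z : ℝ) :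
    |∏' k, (1 + -(r k * z))| ≤ (1 - r i * z) ^ 2 * rexp ((∑' k, r k) * |z|) := by
  have hs' : Summable fun k => ‖-(r k * z)‖ := by
    rw [norm_one_add_neg_mul hr]; exact hs.mul_right _
  have hp := (multipliable_one_add_of_summable hs').hasProd.norm
  refine le_of_tendsto hp ?_
  filter_upwards [eventually_ge_atTop {i, j}] with s hsub
  have hi : i ∈ s := hsub (by simp)
  have hj : j ∈ s.erase i := Finset.mem_erase.2 ⟨hij.symm, hsub (by simp)⟩
  rw [← Finset.mul_prod_erase s _ hi, ← Finset.mul_prod_erase _ _ hj, ← h, ← mul_assoc]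
  have hrest : ∏ x ∈ (s.erase i).erase j, ‖1 + -(r x * z)‖ ≤ rexp ((∑' k, r k) * |z|) := by
    calc ∏ x ∈ (s.erase i).erase j, ‖1 + -(r x * z)‖
        ≤ ∏ x ∈ (s.erase i).erase j, rexp (r x * |z|) := by
          refine Finset.prod_le_prod (fun _ _ => norm_nonneg _) fun x _ => ?_
          calc ‖1 + -(r x * z)‖ ≤ ‖(1 : ℝ)‖ + ‖-(r x * z)‖ := norm_add_le _ _
            _ = r x * |z| + 1 := by
              rw [norm_one, congrFun (norm_one_add_neg_mul hr z) x, add_comm]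
            _ ≤ _ := Real.add_one_le_exp _
      _ = rexp ((∑ x ∈ (s.erase i).erase j, r x) * |z|) := by
          rw [← Real.exp_sum, Finset.sum_mul]
      _ ≤ _ := by
          gcongr
          exact hs.sum_le_tsum _ fun k _ => hr k
  have hsq : ‖1 + -(r i * z)‖ * ‖1 + -(r i * z)‖ = (1 - r i * z) ^ 2 := by
    rw [Real.norm_eq_abs, abs_mul_abs_self]; ring
  rw [hsq]
  gcongr

/-- Repeated factors of the product would produce a multiple zero. -/
lemma ne_of_diniSum_eq_tprod {ν : ℝ} (hν : -1 < ν) {r : ℕ → ℝ} (hr : ∀ i, 0 ≤ r i)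
    (hs : Summable r) (hG : ∀ z, diniSum ν z = ∏' i, (1 + -(r i * z))) {i j : ℕ} (hij : i ≠ j)
    (hi : 0 < r i) : r i ≠ r j := by
  intro h
  set z₀ := (r i)⁻¹
  have hz₀ : 0 < z₀ := inv_pos.2 hi
  have hbd (z : ℝ) : |diniSum ν z| ≤ (1 - r i * z) ^ 2 * rexp ((∑' k, r k) * |z|) := by
    rw [hG]; exact abs_tprod_le_of_eq hr hs hij h z
  have h0 : diniSum ν z₀ = 0 := by
    have := hbd z₀
    rw [mul_inv_cancel₀ hi.ne'] at this
    simpa using this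
  refine deriv_diniSum_ne_zero hν hz₀ h0 (HasDerivAt.deriv ?_)
  rw [hasDerivAt_iff_isLittleO]
  simp only [h0, smul_zero, sub_zero]
  have hlim : Tendsto (fun z => r i ^ 2 * (z - z₀) * rexp ((∑' k, r k) * |z|)) (𝓝 z₀) (𝓝 0) := by
    have : Continuous fun z => r i ^ 2 * (z - z₀) * rexp ((∑' k, r k) * |z|) := by fun_prop
    simpa using this.tendsto z₀
  have ho := ((Asymptotics.isLittleO_one_iff ℝ).2 hlim).mul_isBigO
    (Asymptotics.isBigO_refl (fun z => z - z₀) (𝓝 z₀))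
  simp only [one_mul] at ho
  refine (Asymptotics.IsBigO.of_bound 1 (Eventually.of_forall fun z => ?_)).trans_isLittleO ho
  rw [one_mul, Real.norm_eq_abs]
  refine (hbd z).trans ((le_abs_self _).trans_eq' ?_)
  have : r i * z₀ = 1 := mul_inv_cancel₀ hi.ne'
  rw [← this]; ring

lemma diniSum_eq_zero_iff_of_eq_tprod {ν : ℝ} {r : ℕ → ℝ} (hr : ∀ i, 0 ≤ r i) (hs : Summable r)
    (hG : ∀ z, diniSum ν z = ∏' i, (1 + -(r i * z))) (z : ℝ) :
    diniSum ν z = 0 ↔ ∃ i, r i * z = 1 := by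
  rw [hG]
  constructor
  · contrapose!
    intro h
    refine tprod_one_add_ne_zero_of_summable (fun i hi => h i (by linarith)) ?_
    rw [norm_one_add_neg_mul hr]
    exact hs.mul_right _
  · rintro ⟨i, hi⟩
    exact tprod_of_exists_eq_zero ⟨i, by rw [hi]; norm_num⟩

/-- The Hadamard product of `diniSum ν` in terms of the positive zeros of `dini ν`. -/
lemma diniSum_eq_tprod_zeros {ν : ℝ} (hν : -1 < ν) {α : ℕ → ℝ} (hα0 : α 0 = 0)
    (hmono : StrictMono α) (hzeros : ∀ x : ℝ, (0 < x ∧ dini ν x = 0) ↔ ∃ n, 1 ≤ n ∧ α n = x) :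
    Summable (fun n => (α (n + 1) ^ 2)⁻¹) ∧
      ∀ z, diniSum ν z = ∏' n, (1 + -((α (n + 1) ^ 2)⁻¹ * z)) := by
  obtain ⟨r, hanti, hr, hs, hG⟩ := exists_diniSum_eq_tprod hν
  have hαpos (n : ℕ) : 0 < α (n + 1) := hα0 ▸ hmono n.succ_pos
  have hzero (x : ℝ) (hx : 0 < x) : (∃ n, α (n + 1) = x) ↔ ∃ i, r i * x ^ 2 = 1 := by
    rw [← diniSum_eq_zero_iff_of_eq_tprod hr hs hG, ← dini_eq_zero_iff hν hx]
    constructor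
    · rintro ⟨n, rfl⟩
      exact ((hzeros _).2 ⟨n + 1, by omega, rfl⟩).2
    · intro h
      obtain ⟨n, hn, rfl⟩ := (hzeros x).1 ⟨hx, h⟩
      exact ⟨n - 1, by rw [Nat.sub_add_cancel hn]⟩
  choose e he using fun n => (hzero _ (hαpos n)).1 ⟨n, rfl⟩
  have he_inj : Function.Injective e := by
    intro m n hmn
    have h1 := he m
    rw [hmn] at h1
    have h2 := he n
    have h3 : r (e n) ≠ 0 := by rintro h; simp [h] at h2
    have h4 : α (m + 1) ^ 2 = α (n + 1) ^ 2 := mul_left_cancel₀ h3 (h1.trans h2.symm)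
    have h5 := (pow_left_inj₀ (hαpos m).le (hαpos n).le two_ne_zero).1 h4
    exact Nat.succ_injective (hmono.injective h5)
  have hrpos (i : ℕ) : 0 < r i := by
    obtain ⟨n, hn⟩ : ∃ n, i ≤ e n := by
      by_contra! h
      exact Set.infinite_range_of_injective he_inj
        ((Set.finite_lt_nat i).subset (by rintro _ ⟨n, rfl⟩; exact h n))
    refine ((hr _).lt_of_ne ?_).trans_le (hanti hn)
    intro h
    have := he n
    rw [← h] at this
    simp at this
  have hrstrict : StrictAnti r :=
    hanti.strictAnti_of_injective fun i j hij => by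
      by_contra hne
      exact ne_of_diniSum_eq_tprod hν hr hs hG hne (hrpos i) hij
  have heq : (fun k => (√(r k))⁻¹) = fun k => α (k + 1) := by
    refine (StrictMono.range_inj (fun i j hij => ?_) (fun i j hij => hmono (by omega))).1 ?_
    · exact inv_strictAnti₀ (Real.sqrt_pos.2 (hrpos j)) (Real.sqrt_lt_sqrt (hr j) (hrstrict hij))
    · ext x
      constructor
      · rintro ⟨k, rfl⟩
        have hp := Real.sqrt_pos.2 (hrpos k)
        exact (hzero _ (inv_pos.2 hp)).2 ⟨k, by
          rw [inv_pow, Real.sq_sqrt (hr k), mul_inv_cancel₀ (hrpos k).ne']⟩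
      · rintro ⟨n, rfl⟩
        refine ⟨e n, ?_⟩
        simp only
        rw [eq_inv_of_mul_eq_one_left (he n), Real.sqrt_inv, inv_inv, Real.sqrt_sq (hαpos n).le]
  have hrα : r = fun k => (α (k + 1) ^ 2)⁻¹ := by
    ext k
    rw [← congrFun heq k, inv_pow, inv_inv, Real.sq_sqrt (hr k)]
  subst hrα
  exact ⟨hs, hG⟩

lemma log_tprod_one_add {f : ℕ → ℝ} (hf : ∀ i, 1 + f i ≠ 0) (hs : Summable fun i => ‖f i‖) :
    Real.log (∏' i, (1 + f i)) = ∑' i, Real.log (1 + f i) := by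
  have h := Real.rexp_tsum_eq_tprod (fun i => norm_pos_iff.2 (hf i)) hs.summable_log_norm_one_add
  have h2 := (multipliable_one_add_of_summable hs).hasProd.norm.tprod_eq
  simp only [Real.norm_eq_abs, Real.log_abs] at h h2
  rw [← Real.log_abs, ← h2, ← h, Real.log_exp]

section LogDerivatives

variable {r : ℕ → ℝ} {p q δ : ℝ}

lemma hasDerivAt_tsum_log (hr : ∀ i, 0 ≤ r i) (hs : Summable r) (hp : 0 ≤ p) (hδ : 0 < δ)
    (hbd : ∀ i, ∀ t ∈ Ioo p q, δ ≤ |1 - r i * t ^ 2|) {x : ℝ} (hx : x ∈ Ioo p q) :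
    HasDerivAt (fun t => ∑' i, Real.log (1 + -(r i * t ^ 2)))
      (∑' i, -(2 * r i * x) / (1 - r i * x ^ 2)) x := by
  refine hasDerivAt_tsum_of_isPreconnected (u := fun i => r i * (2 * q / δ))
    (g := fun i t => Real.log (1 + -(r i * t ^ 2)))
    (g' := fun i t => -(2 * r i * t) / (1 - r i * t ^ 2)) (hs.mul_right _)
    isOpen_Ioo isPreconnected_Ioo (fun i y hy => ?_) (fun i y hy => ?_) hx ?_ hx
  · have hne : 1 - r i * y ^ 2 ≠ 0 := abs_pos.1 (hδ.trans_le (hbd i y hy))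
    have h : HasDerivAt (fun t => 1 + -(r i * t ^ 2)) (-(2 * r i * y)) y := by
      have := (((hasDerivAt_pow 2 y).const_mul (r i)).neg).const_add 1
      convert! this using 1
      push_cast; ring
    exact h.log hne
  · have hy0 : 0 ≤ y := hp.trans hy.1.le
    have := hr i
    rw [norm_div, Real.norm_eq_abs, Real.norm_eq_abs, abs_neg, abs_of_nonneg (by positivity)]
    calc 2 * r i * y / |1 - r i * y ^ 2| ≤ 2 * r i * q / δ := by
          gcongr
          · have := hy0.trans hy.2.le; positivity
          · exact hy.2.le
          · exact hbd i y hy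
      _ = r i * (2 * q / δ) := by ring
  · have h : Summable fun i => ‖-(r i * x ^ 2)‖ := by
      rw [norm_one_add_neg_mul hr]; exact hs.mul_right _
    simpa [Real.norm_eq_abs] using h.summable_log_norm_one_add

lemma summable_and_hasDerivAt_tsum_logDeriv (hr : ∀ i, 0 ≤ r i) (hs : Summable r) (hp : 0 ≤ p)
    (hδ : 0 < δ) (hbd : ∀ i, ∀ t ∈ Ioo p q, δ ≤ |1 - r i * t ^ 2|) {x : ℝ} (hx : x ∈ Ioo p q) :
    Summable (fun i => -(2 * r i * (1 + r i * x ^ 2) / (1 - r i * x ^ 2) ^ 2)) ∧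
    HasDerivAt (fun t => ∑' i, -(2 * r i * t) / (1 - r i * t ^ 2))
      (∑' i, -(2 * r i * (1 + r i * x ^ 2) / (1 - r i * x ^ 2) ^ 2)) x := by
  have hu : Summable fun i => r i * (2 * (1 + (∑' j, r j) * q ^ 2) / δ ^ 2) := hs.mul_right _
  have hle (i : ℕ) (y : ℝ) (hy : y ∈ Ioo p q) :
      ‖-(2 * r i * (1 + r i * y ^ 2) / (1 - r i * y ^ 2) ^ 2)‖ ≤
        r i * (2 * (1 + (∑' j, r j) * q ^ 2) / δ ^ 2) := by
    have hy0 : 0 ≤ y := hp.trans hy.1.le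
    have := hr i
    have hS : r i ≤ ∑' j, r j := hs.le_tsum i fun j _ => hr j
    have hS0 := this.trans hS
    rw [norm_neg, Real.norm_of_nonneg (by positivity), ← sq_abs (1 - r i * y ^ 2)]
    calc 2 * r i * (1 + r i * y ^ 2) / |1 - r i * y ^ 2| ^ 2
        ≤ 2 * r i * (1 + (∑' j, r j) * q ^ 2) / δ ^ 2 := by
          gcongr
          · exact hy.2.le
          · exact hbd i y hy
      _ = _ := by ring
  refine ⟨.of_norm_bounded hu fun i => hle i x hx,
    hasDerivAt_tsum_of_isPreconnected hu
    isOpen_Ioo isPreconnected_Ioo (fun i y hy => ?_) hle hx ?_ hx⟩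
  · have hne : 1 - r i * y ^ 2 ≠ 0 := abs_pos.1 (hδ.trans_le (hbd i y hy))
    have h1 : HasDerivAt (fun t => 1 - r i * t ^ 2) (-(2 * r i * y)) y := by
      have := ((hasDerivAt_pow 2 y).const_mul (r i)).const_sub 1
      convert! this using 1
      push_cast; ring
    have h2 : HasDerivAt (fun t => -(2 * r i * t)) (-(2 * r i)) y := by
      convert! ((hasDerivAt_id y).const_mul (2 * r i)).neg using 1
      rw [mul_one]
    convert! h2.div h1 hne using 1
    field_simp
    ring
  · refine .of_norm_bounded (g := fun i => r i * (2 * x / δ)) (hs.mul_right _) fun i => ?_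
    have hx0 : 0 ≤ x := hp.trans hx.1.le
    have := hr i
    rw [norm_div, Real.norm_eq_abs, Real.norm_eq_abs, abs_neg, abs_of_nonneg (by positivity)]
    calc 2 * r i * x / |1 - r i * x ^ 2| ≤ 2 * r i * x / δ := by
          gcongr
          exact hbd i x hx
      _ = r i * (2 * x / δ) := by ring

end LogDerivatives

/-- Between consecutive zeros, all factors of the Hadamard product stay away from zero. -/
lemma exists_le_abs_one_sub {α : ℕ → ℝ} (hα0 : α 0 = 0) (hmono : StrictMono α) {m : ℕ} {x : ℝ}
    (hx : x ∈ Ioo (α m) (α (m + 1))) :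
    ∃ p q δ : ℝ, 0 ≤ p ∧ 0 < δ ∧ x ∈ Ioo p q ∧
      ∀ i, ∀ t ∈ Ioo p q, δ ≤ |1 - (α (i + 1) ^ 2)⁻¹ * t ^ 2| := by
  have hαpos (n : ℕ) : 0 < α (n + 1) := hα0 ▸ hmono n.succ_pos
  have hαm : 0 ≤ α m := hα0 ▸ hmono.monotone m.zero_le
  obtain ⟨p, hp1, hp2⟩ := exists_between hx.1
  obtain ⟨q, hq1, hq2⟩ := exists_between hx.2
  have hp : 0 < p := hαm.trans_lt hp1
  have hδ1 : 0 < 1 - (α (m + 1) ^ 2)⁻¹ * q ^ 2 := by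
    rw [sub_pos, inv_mul_lt_one₀ (pow_pos (hαpos m) 2)]
    gcongr
    exact (hp.trans (hp2.trans hq1)).le
  obtain ⟨δ₂, hδ2, hδ2'⟩ : ∃ δ₂ : ℝ, 0 < δ₂ ∧ ∀ i < m, δ₂ ≤ (α (i + 1) ^ 2)⁻¹ * p ^ 2 - 1 := by
    rcases m.eq_zero_or_pos with rfl | hm
    · exact ⟨1, one_pos, by simp⟩
    · have hm0 : 0 < α m := hα0 ▸ hmono hm
      refine ⟨(α m ^ 2)⁻¹ * p ^ 2 - 1, ?_, fun i hi => ?_⟩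
      · rw [sub_pos, one_lt_inv_mul₀ (pow_pos hm0 2)]
        gcongr
      · have := hαpos i
        have : α (i + 1) ≤ α m := hmono.monotone hi
        gcongr
  refine ⟨p, q, min (1 - (α (m + 1) ^ 2)⁻¹ * q ^ 2) δ₂, hp.le, lt_min hδ1 hδ2, ⟨hp2, hq1⟩,
    fun i t ht => ?_⟩
  have hi0 := hαpos i
  have ht0 : 0 < t := hp.trans ht.1
  rcases lt_or_ge i m with h | h
  · rw [abs_sub_comm]
    refine (min_le_right _ _).trans ((hδ2' i h).trans (le_trans ?_ (le_abs_self _)))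
    gcongr
    exact ht.1.le
  · refine (min_le_left _ _).trans (le_trans ?_ (le_abs_self _))
    have := hαpos m
    have : α (m + 1) ≤ α (i + 1) := hmono.monotone (by omega)
    gcongr
    exact ht.2.le

lemma differentiableAt_gderiv {ν : ℝ} (hν : -1 < ν) {x : ℝ} (hx : 0 < x) :
    DifferentiableAt ℝ (gderiv ν) x := by
  have h : gderiv ν =ᶠ[𝓝 x] fun t => diniSum ν (t ^ 2) := by
    filter_upwards [lt_mem_nhds hx] with t ht using gderiv_eq hν ht
  rw [h.differentiableAt_iff]
  exact ((hasDerivAt_diniSum hν _).differentiableAt).comp x (differentiableAt_pow 2)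

/-- First two derivatives of `log |g_ν'|` between consecutive zeros. -/
lemma hasDerivAt_log_gderiv {ν : ℝ} (hν : -1 < ν) {α : ℕ → ℝ} (hα0 : α 0 = 0)
    (hmono : StrictMono α) (hzeros : ∀ x : ℝ, (0 < x ∧ dini ν x = 0) ↔ ∃ n, 1 ≤ n ∧ α n = x)
    {m : ℕ} {x : ℝ} (hx : x ∈ Ioo (α m) (α (m + 1))) :
    HasDerivAt (fun t => Real.log (gderiv ν t)) (deriv (gderiv ν) x / gderiv ν x) x ∧
    HasDerivAt (fun t => deriv (gderiv ν) t / gderiv ν t)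
      (-∑' n : ℕ, 2 * (α (n + 1) ^ 2 + x ^ 2) / (α (n + 1) ^ 2 - x ^ 2) ^ 2) x ∧
    0 < ∑' n : ℕ, 2 * (α (n + 1) ^ 2 + x ^ 2) / (α (n + 1) ^ 2 - x ^ 2) ^ 2 := by
  have hαpos (n : ℕ) : 0 < α (n + 1) := hα0 ▸ hmono n.succ_pos
  obtain ⟨hs, hG⟩ := diniSum_eq_tprod_zeros hν hα0 hmono hzeros
  obtain ⟨p, q, δ, hp, hδ, hxpq, hbd⟩ := exists_le_abs_one_sub hα0 hmono hx
  have hr (i : ℕ) : 0 ≤ (α (i + 1) ^ 2)⁻¹ := by positivity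
  have hne (i : ℕ) {t : ℝ} (ht : t ∈ Ioo p q) : 1 - (α (i + 1) ^ 2)⁻¹ * t ^ 2 ≠ 0 :=
    abs_pos.1 (hδ.trans_le (hbd i t ht))
  have hsum (t : ℝ) : Summable fun i => ‖-((α (i + 1) ^ 2)⁻¹ * t ^ 2)‖ := by
    rw [norm_one_add_neg_mul hr]; exact hs.mul_right _
  have hg (t : ℝ) (ht : t ∈ Ioo p q) :
      gderiv ν t = ∏' n, (1 + -((α (n + 1) ^ 2)⁻¹ * t ^ 2)) := by
    rw [gderiv_eq hν (hp.trans_lt ht.1), hG]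
  have hg0 (t : ℝ) (ht : t ∈ Ioo p q) : gderiv ν t ≠ 0 := by
    rw [hg t ht]
    exact tprod_one_add_ne_zero_of_summable (fun i => hne i ht) (hsum t)
  have hlog (t : ℝ) (ht : t ∈ Ioo p q) : HasDerivAt (fun t => Real.log (gderiv ν t))
      (deriv (gderiv ν) t / gderiv ν t) t :=
    (differentiableAt_gderiv hν (hp.trans_lt ht.1)).hasDerivAt.log (hg0 t ht)
  have hquot (t : ℝ) (ht : t ∈ Ioo p q) : deriv (gderiv ν) t / gderiv ν t =
      ∑' i, -(2 * (α (i + 1) ^ 2)⁻¹ * t) / (1 - (α (i + 1) ^ 2)⁻¹ * t ^ 2) := by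
    refine (hlog t ht).unique ((hasDerivAt_tsum_log hr hs hp hδ hbd ht).congr_of_eventuallyEq ?_)
    filter_upwards [isOpen_Ioo.mem_nhds ht] with s hs'
    rw [hg s hs', log_tprod_one_add (fun i => hne i hs') (hsum s)]
  obtain ⟨hsum2, hderiv2⟩ := summable_and_hasDerivAt_tsum_logDeriv hr hs hp hδ hbd hxpq
  have hterm (n : ℕ) : -(2 * (α (n + 1) ^ 2)⁻¹ * (1 + (α (n + 1) ^ 2)⁻¹ * x ^ 2) /
      (1 - (α (n + 1) ^ 2)⁻¹ * x ^ 2) ^ 2) =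
      -(2 * (α (n + 1) ^ 2 + x ^ 2) / (α (n + 1) ^ 2 - x ^ 2) ^ 2) := by
    have h1 := (hαpos n).ne'
    have h2 := hne n hxpq
    have h3 : α (n + 1) ^ 2 - x ^ 2 ≠ 0 := by
      intro h
      apply h2
      rw [← sub_eq_zero.1 h, inv_mul_cancel₀ (pow_ne_zero 2 h1), sub_self]
    rw [neg_inj, div_eq_div_iff (pow_ne_zero 2 h2) (pow_ne_zero 2 h3)]
    field_simp
  simp only [hterm] at hsum2 hderiv2
  refine ⟨hlog x hxpq, ?_, ?_⟩
  · rw [← tsum_neg]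
    refine hderiv2.congr_of_eventuallyEq ?_
    filter_upwards [isOpen_Ioo.mem_nhds hxpq] with t ht using hquot t ht
  · have hnn (n : ℕ) : 0 ≤ 2 * (α (n + 1) ^ 2 + x ^ 2) / (α (n + 1) ^ 2 - x ^ 2) ^ 2 := by
      positivity
    refine (summable_neg_iff.1 hsum2).tsum_pos hnn 0 ?_
    have h1 := hαpos 0
    have h3 : α (0 + 1) ^ 2 - x ^ 2 ≠ 0 := by
      intro h
      apply hne 0 hxpq
      rw [← sub_eq_zero.1 h, inv_mul_cancel₀ (pow_ne_zero 2 h1.ne'), sub_self]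
    positivity

/-- Let `ν > -1`, with `α 1 < α 2 < ⋯` the positive zeros of `d_ν`,
`α 0 = 0`, and `Δ_ν = ⋃_{k ≥ 0} (α (2k), α (2k+1))`.  Then
`g_ν'(x) = 2^ν Γ(ν+1) x^{-ν} d_ν(x)` is strictly log-concave on each component interval
of `Δ_ν`; that is,
`(d/dx)(g_ν''(x)/g_ν'(x)) = -∑_{n ≥ 1} 2 (α_n² + x²)/(α_n² - x²)² < 0` for all `x ∈ Δ_ν`. -/
theorem gderiv_strictly_log_concave (ν : ℝ) (hν : -1 < ν) (α : ℕ → ℝ)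
    (hα0 : α 0 = 0) (hmono : StrictMono α)
    (hzeros : ∀ x : ℝ, (0 < x ∧ dini ν x = 0) ↔ ∃ n, 1 ≤ n ∧ α n = x) :
    (∀ k : ℕ, StrictConcaveOn ℝ (Set.Ioo (α (2 * k)) (α (2 * k + 1)))
      (fun x : ℝ => Real.log (gderiv ν x))) ∧
    (∀ x ∈ ⋃ k : ℕ, Set.Ioo (α (2 * k)) (α (2 * k + 1)),
      deriv (fun t : ℝ => deriv (gderiv ν) t / gderiv ν t) x =
        -∑' n : ℕ, 2 * ((α (n + 1)) ^ 2 + x ^ 2) / ((α (n + 1)) ^ 2 - x ^ 2) ^ 2 ∧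
      deriv (fun t : ℝ => deriv (gderiv ν) t / gderiv ν t) x < 0) := by
  refine ⟨fun k => ?_, fun x hx => ?_⟩
  · have h (x : ℝ) (hx : x ∈ Ioo (α (2 * k)) (α (2 * k + 1))) :=
      hasDerivAt_log_gderiv hν hα0 hmono hzeros hx
    refine strictConcaveOn_of_deriv2_neg' (convex_Ioo _ _)
      (fun x hx => (h x hx).1.continuousAt.continuousWithinAt) fun x hx => ?_
    have he : deriv (fun t => Real.log (gderiv ν t)) =ᶠ[𝓝 x]
        fun t => deriv (gderiv ν) t / gderiv ν t := by
      filter_upwards [isOpen_Ioo.mem_nhds hx] with t ht using (h t ht).1.deriv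
    obtain ⟨-, h2, h3⟩ := h x hx
    rw [Function.iterate_succ_apply, Function.iterate_one, he.deriv_eq, h2.deriv]
    exact neg_lt_zero.2 h3
  · obtain ⟨k, hk⟩ := mem_iUnion.1 hx
    obtain ⟨-, h2, h3⟩ := hasDerivAt_log_gderiv hν hα0 hmono hzeros hk
    rw [h2.deriv]
    exact ⟨rfl, neg_lt_zero.2 h3⟩
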